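/- arXiv:1401.3388 — 3 statements merged into one kernel-verified Lean document; each statement's English description precedes it below -/
import Mathlib

section
/- Fractional Moyal identity: for every θ ∈ ℝ and all Schwartz functions ψ, φ on ℝ^n, ∫∫_{ℝ^n × ℝ^n} |W^θ(ψ,φ)(x,p)|² dx dp = (2π)^{−n} ‖ψ‖²_{L²(ℝ^n)} ‖φ‖²_{L²(ℝ^n)}. -/
open MeasureTheory Real SchwartzMap
open scoped InnerProductSpace ComplexConjugate

noncomputable section

/-- `ℝ^n` as a Euclidean space. -/
abbrev En (n : ℕ) := EuclideanSpace ℝ (Fin n)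

/-- The linear flow `M(θ)` on `ℝ^n × ℝ^n` (with `k = √7`). -/
def Mflow (n : ℕ) (θ : ℝ) (z : En n × En n) : En n × En n :=
  ((Real.cos (Real.sqrt 7 * θ) - (Real.sqrt 7)⁻¹ * Real.sin (Real.sqrt 7 * θ)) • z.1
     + (2 * (Real.sqrt 7)⁻¹ * Real.sin (Real.sqrt 7 * θ)) • z.2,
   (-(4 * (Real.sqrt 7)⁻¹ * Real.sin (Real.sqrt 7 * θ))) • z.1
     + (Real.cos (Real.sqrt 7 * θ) + (Real.sqrt 7)⁻¹ * Real.sin (Real.sqrt 7 * θ)) • z.2)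

/-- The special parameter value `θ₀ = (1/√7)·arccos(3/4)`. -/
def θ₀ : ℝ := (Real.sqrt 7)⁻¹ * Real.arccos (3 / 4)

/-- The Fourier transform `φ̂(p) = (2π)^{-n/2} ∫ e^{-i p·y} φ(y) dy`. -/
def FT (n : ℕ) (φ : En n → ℂ) (p : En n) : ℂ :=
  (((2 * Real.pi) ^ (-(n : ℝ) / 2) : ℝ) : ℂ) *
    ∫ y : En n, Complex.exp (-(Complex.I * (⟪p, y⟫_ℝ : ℂ))) * φ y

/-- Partial Fourier transform in the second variable. -/
def F2 (n : ℕ) (Ψ : En n × En n → ℂ) (z : En n × En n) : ℂ :=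
  (((2 * Real.pi) ^ (-(n : ℝ) / 2) : ℝ) : ℂ) *
    ∫ p : En n, Complex.exp (-(Complex.I * (⟪z.2, p⟫_ℝ : ℂ))) * Ψ (z.1, p)

/-- Inverse partial Fourier transform in the second variable. -/
def F2inv (n : ℕ) (Ψ : En n × En n → ℂ) (z : En n × En n) : ℂ :=
  (((2 * Real.pi) ^ (-(n : ℝ) / 2) : ℝ) : ℂ) *
    ∫ ξ : En n, Complex.exp (Complex.I * (⟪ξ, z.2⟫_ℝ : ℂ)) * Ψ (z.1, ξ)

/-- The operator `U(θ) = F₂⁻¹ ∘ T(θ) ∘ F₂`, where `T(θ)Φ = Φ ∘ M(-θ)`. -/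
def Uop (n : ℕ) (θ : ℝ) (Ψ : En n × En n → ℂ) : En n × En n → ℂ :=
  F2inv n (fun z => F2 n Ψ (Mflow n (-θ) z))

/-- The cross Wigner function. -/
def Wig (n : ℕ) (ψ φ : En n → ℂ) (z : En n × En n) : ℂ :=
  (((2 * Real.pi) ^ (-(n : ℝ)) : ℝ) : ℂ) *
    ∫ ξ : En n, Complex.exp (Complex.I * (⟪z.2, ξ⟫_ℝ : ℂ)) *
      ψ (z.1 - (2⁻¹ : ℝ) • ξ) * conj (φ (z.1 + (2⁻¹ : ℝ) • ξ))

/-- The fractional cross Wigner function `W^θ(ψ,φ) = (2π)^{-n/2} U(θ)(ψ ⊗ conj φ̂)`. -/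
def fWig (n : ℕ) (θ : ℝ) (ψ φ : En n → ℂ) (z : En n × En n) : ℂ :=
  (((2 * Real.pi) ^ (-(n : ℝ) / 2) : ℝ) : ℂ) *
    Uop n θ (fun w => ψ w.1 * conj (FT n φ w.2)) z

/-- Inverse Fourier transform of a kernel in its second variable. -/
def GK (n : ℕ) (K : En n × En n → ℂ) (z : En n × En n) : ℂ :=
  (((2 * Real.pi) ^ (-(n : ℝ) / 2) : ℝ) : ℂ) *
    ∫ y : En n, Complex.exp (Complex.I * (⟪z.2, y⟫_ℝ : ℂ)) * K (z.1, y)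

/-- The Weyl pseudo-differential operator with symbol `a`. -/
def OpW (n : ℕ) (a : En n × En n → ℂ) (ψ : En n → ℂ) (x : En n) : ℂ :=
  (((2 * Real.pi) ^ (-(n : ℝ)) : ℝ) : ℂ) *
    ∫ w : En n × En n, Complex.exp (Complex.I * (⟪x - w.1, w.2⟫_ℝ : ℂ)) *
      a ((2⁻¹ : ℝ) • (x + w.1), w.2) * ψ w.1

/-- The phase-space extension `Â` of the Weyl operator with symbol `a`. -/
def hatA (n : ℕ) (a : En n × En n → ℂ) (Ψ : En n × En n → ℂ) (z : En n × En n) : ℂ :=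
  (((2 * Real.pi) ^ (-(n : ℝ)) : ℝ) : ℂ) *
    ∫ w : En n × En n, Complex.exp (Complex.I * (⟪z.1 - w.1, w.2⟫_ℝ : ℂ)) *
      a ((2⁻¹ : ℝ) • (z.1 + w.1), w.2) * Ψ (w.1, z.2)

lemma SchwartzMap.exists_bilin_comp_affine {E : Type*} [NormedAddCommGroup E] [NormedSpace ℝ E]
    (B : ℂ →L[ℝ] ℂ →L[ℝ] ℂ) (f g : 𝓢(E, ℂ)) (u v : E) {b : ℝ} (hb : b ≠ 0) (d : ℝ) :
    ∃ s : 𝓢(E, ℂ), ∀ ξ, s ξ = B (f (u + b • ξ)) (g (v + d • ξ)) := by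
  have affine (w : E) (r : ℝ) : Function.HasTemperateGrowth (fun ξ : E => w + r • ξ) :=
    (Function.HasTemperateGrowth.const w).add (r • ContinuousLinearMap.id ℝ E).hasTemperateGrowth
  have anti : AntilipschitzWith ‖b‖₊⁻¹ (fun ξ : E => u + b • ξ) := by
    refine AntilipschitzWith.of_le_mul_dist fun x y => ?_
    rw [dist_add_left, dist_smul₀, NNReal.coe_inv, coe_nnnorm,
      inv_mul_cancel_left₀ (norm_ne_zero_iff.mpr hb)]
  exact ⟨bilinLeftCLM B (g.hasTemperateGrowth.comp (affine v d))
    (compCLMOfAntilipschitz ℝ (affine u b) anti f), fun _ => rfl⟩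

lemma SchwartzMap.exists_mul_conj_comp_affine {E : Type*} [NormedAddCommGroup E] [NormedSpace ℝ E]
    (f g : 𝓢(E, ℂ)) (u v : E) {b d : ℝ} (h : b ≠ 0 ∨ d ≠ 0) :
    ∃ s : 𝓢(E, ℂ), ∀ ξ, s ξ = f (u + b • ξ) * conj (g (v + d • ξ)) := by
  let B : ℂ →L[ℝ] ℂ →L[ℝ] ℂ :=
    ((ContinuousLinearMap.mul ℝ ℂ).flip ∘L (Complex.conjCLE : ℂ →L[ℝ] ℂ)).flip
  rcases h with hb | hd
  · exact exists_bilin_comp_affine B f g u v hb d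
  · exact exists_bilin_comp_affine B.flip g f v u hd b

lemma lintegral_comp_affine {E : Type*} [NormedAddCommGroup E] [NormedSpace ℝ E]
    [FiniteDimensional ℝ E] [MeasurableSpace E] [BorelSpace E] (μ : Measure E) [μ.IsAddHaarMeasure]
    {f : E → ENNReal} (hf : Measurable f) {r : ℝ} (hr : r ≠ 0) (v : E) :
    ∫⁻ x, f (v + r • x) ∂μ = ENNReal.ofReal |(r ^ Module.finrank ℝ E)⁻¹| * ∫⁻ x, f x ∂μ := by
  have hv : Measurable fun x => f (v + x) := hf.comp (measurable_const_add v)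
  rw [← lintegral_map hv (measurable_const_smul r), Measure.map_addHaar_smul μ hr,
    lintegral_smul_measure, lintegral_add_left_eq_self, smul_eq_mul]

lemma lintegral_prod_comp_unimodular {E : Type*} [NormedAddCommGroup E] [NormedSpace ℝ E]
    [FiniteDimensional ℝ E] [MeasurableSpace E] [BorelSpace E] (μ : Measure E) [μ.IsAddHaarMeasure]
    {f g : E → ENNReal} (hf : Measurable f) (hg : Measurable g) {a b c d : ℝ}
    (hdet : a * d - b * c = 1) :
    ∫⁻ x, ∫⁻ ξ, f (a • x + b • ξ) * g (c • x + d • ξ) ∂μ ∂μ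
      = (∫⁻ x, f x ∂μ) * ∫⁻ x, g x ∂μ := by
  set m := Module.finrank ℝ E
  have cancel {r s : ℝ} (h : r * s = 1) :
      ENNReal.ofReal |(r ^ m)⁻¹| * ENNReal.ofReal |(s ^ m)⁻¹| = 1 := by
    rw [← ENNReal.ofReal_mul (abs_nonneg _), ← abs_mul, ← mul_inv, ← mul_pow, h]
    simp
  rcases eq_or_ne b 0 with rfl | hb
  · have had : a * d = 1 := by linarith
    have ha : a ≠ 0 := left_ne_zero_of_mul_eq_one had
    have hd : d ≠ 0 := right_ne_zero_of_mul_eq_one had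
    have inner (x : E) : ∫⁻ ξ, f (a • x + (0 : ℝ) • ξ) * g (c • x + d • ξ) ∂μ
        = f (0 + a • x) * (ENNReal.ofReal |(d ^ m)⁻¹| * ∫⁻ y, g y ∂μ) := by
      simp only [zero_smul, add_zero, zero_add]
      rw [lintegral_const_mul _ (by fun_prop), lintegral_comp_affine μ hg hd]
    simp_rw [inner]
    rw [lintegral_mul_const _ (by fun_prop), lintegral_comp_affine μ hf ha,
      mul_mul_mul_comm, cancel had, one_mul]
  · have inner (x : E) : ∫⁻ ξ, f (a • x + b • ξ) * g (c • x + d • ξ) ∂μ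
        = ENNReal.ofReal |(b ^ m)⁻¹| * ∫⁻ y, f y * g ((d * b⁻¹) • y + (-b⁻¹) • x) ∂μ := by
      rw [← lintegral_comp_affine μ (by fun_prop) hb (a • x)]
      congr! 4 with ξ
      have hc : c = (a * d - 1) * b⁻¹ := by field_simp; linarith
      rw [hc]
      match_scalars <;> field_simp
      ring
    simp_rw [inner]
    rw [lintegral_const_mul _ (by fun_prop), lintegral_lintegral_swap (by fun_prop)]
    have outer (y : E) : ∫⁻ x, f y * g ((d * b⁻¹) • y + (-b⁻¹) • x) ∂μ
        = f y * (ENNReal.ofReal |((-b⁻¹) ^ m)⁻¹| * ∫⁻ x, g x ∂μ) := by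
      rw [lintegral_const_mul _ (by fun_prop), lintegral_comp_affine μ hg (by simpa using hb)]
    have habs : |((-b⁻¹) ^ m)⁻¹| = |((b⁻¹) ^ m)⁻¹| := by simp [abs_inv, abs_pow, abs_neg]
    simp_rw [outer]
    rw [lintegral_mul_const _ hf, habs, mul_left_comm, ← mul_assoc (ENNReal.ofReal _),
      cancel (mul_inv_cancel₀ hb), one_mul]

lemma F2inv_eq_fourierInv (n : ℕ) (Ψ : En n × En n → ℂ) (z : En n × En n) :
    F2inv n Ψ z = (((2 * π) ^ (-(n : ℝ) / 2) : ℝ) : ℂ) *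
      FourierTransformInv.fourierInv (fun ξ => Ψ (z.1, ξ)) ((2 * π)⁻¹ • z.2) := by
  rw [F2inv, Real.fourierInv_eq']
  congr! 4 with ξ
  rw [real_inner_smul_right]
  congr 1
  push_cast
  field_simp

lemma FT_eq_fourier (n : ℕ) (φ : En n → ℂ) (p : En n) :
    FT n φ p = (((2 * π) ^ (-(n : ℝ) / 2) : ℝ) : ℂ) *
      FourierTransform.fourier φ ((2 * π)⁻¹ • p) := by
  rw [FT, Real.fourier_eq']
  congr! 4 with ξ
  rw [real_inner_smul_right, real_inner_comm]
  congr 2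
  push_cast
  field_simp

lemma two_pi_rpow_neg_half_mul_self (n : ℕ) :
    (2 * π) ^ (-(n : ℝ) / 2) * (2 * π) ^ (-(n : ℝ) / 2) = ((2 * π) ^ n)⁻¹ := by
  rw [← Real.rpow_add (by positivity), add_halves, Real.rpow_neg (by positivity), Real.rpow_natCast]

lemma FT_inversion (n : ℕ) (φ : 𝓢(En n, ℂ)) (ξ : En n) :
    (((2 * π) ^ (-(n : ℝ) / 2) : ℝ) : ℂ) *
      ∫ p : En n, Complex.exp (Complex.I * (⟪ξ, p⟫_ℝ : ℂ)) * FT n φ p = φ ξ := by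
  have hinv : FourierTransformInv.fourierInv (FourierTransform.fourier (φ : En n → ℂ)) ξ = φ ξ := by
    rw [← SchwartzMap.fourier_coe, ← SchwartzMap.fourierInv_coe,
      FourierTransform.fourierInv_fourier_eq]
  have hint : ∫ p : En n, Complex.exp (Complex.I * (⟪ξ, p⟫_ℝ : ℂ)) * FT n φ p
      = (((2 * π) ^ (-(n : ℝ) / 2) : ℝ) : ℂ) * (((2 * π) ^ n : ℝ) * φ ξ) := by
    rw [← hinv, Real.fourierInv_eq', ← Complex.real_smul (x := (2 * π) ^ n)]
    have := Measure.integral_comp_inv_smul_of_nonneg volume (fun q : En n =>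
      Complex.exp (((2 * π * ⟪q, ξ⟫_ℝ : ℝ) : ℂ) * Complex.I) •
        FourierTransform.fourier (φ : En n → ℂ) q) (R := 2 * π) (by positivity)
    rw [finrank_euclideanSpace_fin] at this
    rw [← this, ← integral_const_mul]
    congr! 2 with p
    rw [FT_eq_fourier, smul_eq_mul, real_inner_smul_left, real_inner_comm, mul_left_comm]
    congr 3
    push_cast
    field_simp
  rw [hint, ← mul_assoc, ← mul_assoc, ← Complex.ofReal_mul, two_pi_rpow_neg_half_mul_self,
    ← Complex.ofReal_mul, inv_mul_cancel₀ (by positivity), Complex.ofReal_one, one_mul]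

lemma F2_tensor_conj_FT (n : ℕ) (ψ : En n → ℂ) (φ : 𝓢(En n, ℂ)) (z : En n × En n) :
    F2 n (fun w => ψ w.1 * conj (FT n φ w.2)) z = ψ z.1 * conj (φ z.2) := by
  rw [F2, ← FT_inversion n φ z.2, map_mul, Complex.conj_ofReal, ← integral_conj, mul_left_comm,
    ← integral_const_mul (ψ z.1)]
  congr! 3 with p
  rw [map_mul, ← Complex.exp_conj, map_mul, Complex.conj_I, Complex.conj_ofReal]
  ring_nf

lemma SchwartzMap.lintegral_norm_sq_fourierInv {V : Type*} [NormedAddCommGroup V]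
    [InnerProductSpace ℝ V] [FiniteDimensional ℝ V] [MeasurableSpace V] [BorelSpace V]
    (s : 𝓢(V, ℂ)) :
    ∫⁻ p, ENNReal.ofReal (‖FourierTransformInv.fourierInv (s : V → ℂ) p‖ ^ 2)
      = ∫⁻ x, ENNReal.ofReal (‖s x‖ ^ 2) := by
  have hint (f : 𝓢(V, ℂ)) : Integrable (fun x => ‖f x‖ ^ 2) :=
    (f.memLp 2 volume).integrable_norm_pow two_ne_zero
  rw [← SchwartzMap.fourierInv_coe, ← ofReal_integral_eq_lintegral_ofReal (hint _)
    (.of_forall fun _ => by positivity), ← ofReal_integral_eq_lintegral_ofReal (hint _)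
    (.of_forall fun _ => by positivity), ← integral_norm_sq_fourier,
    FourierTransform.fourier_fourierInv_eq]

lemma measurable_F2inv (n : ℕ) {Ψ : En n × En n → ℂ} (hΨ : Continuous Ψ) :
    Measurable (F2inv n Ψ) := by
  have : Continuous fun q : (En n × En n) × En n =>
      Complex.exp (Complex.I * (⟪q.2, q.1.2⟫_ℝ : ℂ)) * Ψ (q.1.1, q.2) := by fun_prop
  exact (this.stronglyMeasurable.integral_prod_right (ν := volume)).measurable.const_mul _

lemma lintegral_norm_sq_F2inv (n : ℕ) {Ψ : En n × En n → ℂ} (x : En n) (s : 𝓢(En n, ℂ))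
    (hs : ∀ ξ, s ξ = Ψ (x, ξ)) :
    ∫⁻ p, ENNReal.ofReal (‖F2inv n Ψ (x, p)‖ ^ 2) = ∫⁻ ξ, ENNReal.ofReal (‖Ψ (x, ξ)‖ ^ 2) := by
  have hfun : (fun ξ => Ψ (x, ξ)) = s := funext fun ξ => (hs ξ).symm
  have hmeas : Measurable fun q =>
      ENNReal.ofReal (‖FourierTransformInv.fourierInv (s : En n → ℂ) q‖ ^ 2) := by
    rw [← SchwartzMap.fourierInv_coe]
    fun_prop
  have hscale := lintegral_comp_affine volume hmeas (r := (2 * π)⁻¹) (by positivity) 0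
  simp only [zero_add, finrank_euclideanSpace_fin] at hscale
  simp_rw [F2inv_eq_fourierInv, hfun, norm_mul, mul_pow, ENNReal.ofReal_mul (sq_nonneg _)]
  rw [lintegral_const_mul' _ _ ENNReal.ofReal_ne_top, hscale, s.lintegral_norm_sq_fourierInv, ← mul_assoc,
    ← ENNReal.ofReal_mul (sq_nonneg _), Complex.norm_real, Real.norm_eq_abs, sq_abs, sq,
    two_pi_rpow_neg_half_mul_self, inv_pow, inv_inv, abs_of_pos (by positivity),
    inv_mul_cancel₀ (by positivity), ENNReal.ofReal_one, one_mul]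
  simp_rw [hs]

lemma exists_Mflow_eq (n : ℕ) (θ : ℝ) : ∃ a b c d : ℝ, a * d - b * c = 1 ∧
    ∀ z : En n × En n, Mflow n θ z = (a • z.1 + b • z.2, c • z.1 + d • z.2) := by
  refine ⟨_, _, _, _, ?_, fun z => rfl⟩
  have h7 : (√7)⁻¹ ^ 2 = 1 / 7 := by rw [inv_pow, Real.sq_sqrt (by norm_num)]; norm_num
  linear_combination Real.sin_sq_add_cos_sq (√7 * θ) + 7 * Real.sin (√7 * θ) ^ 2 * h7

/-- Fractional Moyal identity:
`∫∫ |W^θ(ψ,φ)|² = (2π)^{−n} ‖ψ‖²_{L²} ‖φ‖²_{L²}` for Schwartz `ψ, φ`. -/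
theorem statement8 (n : ℕ) (θ : ℝ) (ψ φ : SchwartzMap (En n) ℂ) :
    ∫ z : En n × En n, ‖fWig n θ (⇑ψ) (⇑φ) z‖ ^ 2
      = ((2 * Real.pi) ^ (-(n : ℝ)) : ℝ) *
          ((∫ x : En n, ‖ψ x‖ ^ 2) * ∫ x : En n, ‖φ x‖ ^ 2) := by
  obtain ⟨a, b, c, d, hdet, hM⟩ := exists_Mflow_eq n (-θ)
  set G : En n × En n → ℂ := fun z =>
    ψ (a • z.1 + b • z.2) * conj (φ (c • z.1 + d • z.2)) with hG
  have hU (z : En n × En n) : fWig n θ ψ φ z =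
      (((2 * π) ^ (-(n : ℝ) / 2) : ℝ) : ℂ) * F2inv n G z := by
    simp only [fWig, Uop, F2_tensor_conj_FT, hM, hG]
  have hGcont : Continuous G := by fun_prop
  have hmeas := measurable_F2inv n hGcont
  have hbd : b ≠ 0 ∨ d ≠ 0 := by
    by_contra! h
    simp [h.1, h.2] at hdet
  have hslice (x : En n) := lintegral_norm_sq_F2inv n x
    (ψ.exists_mul_conj_comp_affine φ (a • x) (c • x) hbd).choose
    (Ψ := G) (ψ.exists_mul_conj_comp_affine φ (a • x) (c • x) hbd).choose_spec
  have hL : ∫⁻ z, ENNReal.ofReal (‖F2inv n G z‖ ^ 2)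
      = (∫⁻ x, ENNReal.ofReal (‖ψ x‖ ^ 2)) * ∫⁻ x, ENNReal.ofReal (‖φ x‖ ^ 2) := by
    rw [Measure.volume_eq_prod, lintegral_prod _ (by fun_prop)]
    simp_rw [hslice, hG, norm_mul, mul_pow, RCLike.norm_conj, ENNReal.ofReal_mul (sq_nonneg _)]
    exact lintegral_prod_comp_unimodular volume (f := fun x => ENNReal.ofReal (‖ψ x‖ ^ 2))
      (g := fun x => ENNReal.ofReal (‖φ x‖ ^ 2)) (by fun_prop) (by fun_prop) hdet
  simp_rw [hU, norm_mul, mul_pow]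
  rw [integral_const_mul, Complex.norm_real, Real.norm_eq_abs, sq_abs, sq,
    ← Real.rpow_add (by positivity), add_halves]
  congr 1
  rw [integral_eq_lintegral_of_nonneg_ae (.of_forall fun _ => sq_nonneg _) (by fun_prop), hL,
    ENNReal.toReal_mul, ← integral_eq_lintegral_of_nonneg_ae (.of_forall fun _ => sq_nonneg _)
      (by fun_prop), ← integral_eq_lintegral_of_nonneg_ae (.of_forall fun _ => sq_nonneg _)
      (by fun_prop)]
end
end

section
/- Metaplectic formulation of the Weyl symbol: let K be a Schwartz function on ℝ^n × ℝ^n, and let a_K(x,p) = ∫_{ℝ^n} e^{−i p·y} K(x + y/2, x − y/2) dy be its Weyl symbol. Then for all (x,p) ∈ ℝ^n × ℝ^n, a_K(x,p) = (2π)^{n/2} · U(θ₀)(G K)(x,p), where (G K)(x,p) = (2π)^{−n/2} ∫_{ℝ^n} e^{i p·y} K(x,y) dy is the inverse Fourier transform of K in its second variable. -/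
open MeasureTheory Real SchwartzMap
open scoped InnerProductSpace ComplexConjugate

noncomputable section

/-- The restriction `y ↦ f (a, y)` of a Schwartz function on a product to a slice. -/
def SchwartzMap.slice {E F G : Type*} [NormedAddCommGroup E] [NormedSpace ℝ E]
    [NormedAddCommGroup F] [NormedSpace ℝ F] [NormedAddCommGroup G] [NormedSpace ℝ G]
    (f : 𝓢(E × F, G)) (a : E) : 𝓢(F, G) :=
  SchwartzMap.compCLMOfAntilipschitz ℝ (K := 1) (g := fun y : F => (a, y))
    (by
      have h := (Function.HasTemperateGrowth.const (E := F) ((a, 0) : E × F)).add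
        (ContinuousLinearMap.inr ℝ E F).hasTemperateGrowth
      convert h using 1
      ext y <;> simp)
    (AntilipschitzWith.of_le_mul_dist fun y z => by simp [Prod.dist_eq]) f

@[simp]
theorem SchwartzMap.slice_apply {E F G : Type*} [NormedAddCommGroup E] [NormedSpace ℝ E]
    [NormedAddCommGroup F] [NormedSpace ℝ F] [NormedAddCommGroup G] [NormedSpace ℝ G]
    (f : 𝓢(E × F, G)) (a : E) (y : F) : f.slice a y = f (a, y) := rfl

open scoped FourierTransform

theorem integral_exp_inner_eq_fourierInv {n : ℕ} (f : En n → ℂ) (p : En n) :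
    ∫ y : En n, Complex.exp (Complex.I * (⟪p, y⟫_ℝ : ℂ)) * f y = 𝓕⁻ f ((2 * π)⁻¹ • p) := by
  rw [Real.fourierInv_eq']
  refine integral_congr_ae (.of_forall fun y => ?_)
  simp only [smul_eq_mul, inner_smul_right, real_inner_comm]
  congr 2
  rw [mul_inv_cancel_left₀ (by positivity), mul_comm]

theorem integral_exp_neg_inner_comp_smul {n : ℕ} (g : En n → ℂ) (b : En n) :
    ∫ p : En n, Complex.exp (-(Complex.I * (⟪b, p⟫_ℝ : ℂ))) * g ((2 * π)⁻¹ • p)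
      = (((2 * π) ^ n : ℝ) : ℂ) * 𝓕 g b := by
  have h := Measure.integral_comp_smul (volume : Measure (En n))
    (fun q : En n => Complex.exp (-(Complex.I * ((2 * π * ⟪b, q⟫_ℝ : ℝ) : ℂ))) * g q) (2 * π)⁻¹
  have hπ : (0 : ℝ) ≤ 2 * π := by positivity
  simp only [inner_smul_right, mul_inv_cancel_left₀ (show (2 * π : ℝ) ≠ 0 by positivity),
    finrank_euclideanSpace, Fintype.card_fin, inv_pow, inv_inv, abs_of_nonneg (pow_nonneg hπ n),
    Complex.real_smul] at h
  rw [h, Real.fourier_eq']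
  congr 1
  refine integral_congr_ae (.of_forall fun q => ?_)
  simp only [smul_eq_mul, real_inner_comm]
  congr 2
  push_cast
  ring

theorem F2_GK {n : ℕ} (K : 𝓢(En n × En n, ℂ)) (z : En n × En n) : F2 n (GK n K) z = K z := by
  obtain ⟨a, b⟩ := z
  have hinv : 𝓕 (𝓕⁻ (K.slice a : En n → ℂ)) b = K (a, b) := by
    rw [← SchwartzMap.fourierInv_coe, ← SchwartzMap.fourier_coe,
      FourierTransform.fourier_fourierInv_eq, SchwartzMap.slice_apply]
  have hslice (p : En n) := integral_exp_inner_eq_fourierInv (K.slice a) p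
  simp only [SchwartzMap.slice_apply] at hslice
  have hc : ((2 * π) ^ (-(n : ℝ) / 2) : ℝ) * (2 * π) ^ (-(n : ℝ) / 2) * (2 * π) ^ n = 1 := by
    rw [← Real.rpow_natCast, ← Real.rpow_add (by positivity), ← Real.rpow_add (by positivity)]
    ring_nf
    exact Real.rpow_zero _
  simp only [F2, GK, hslice, mul_left_comm (Complex.exp _), integral_const_mul]
  rw [integral_exp_neg_inner_comp_smul, hinv, ← mul_assoc, ← mul_assoc]
  rw [← Complex.ofReal_mul, ← Complex.ofReal_mul, hc, Complex.ofReal_one, one_mul]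

theorem Mflow_neg_θ₀ (n : ℕ) (z : En n × En n) :
    Mflow n (-θ₀) z = (z.1 - (2⁻¹ : ℝ) • z.2, z.1 + (2⁻¹ : ℝ) • z.2) := by
  have h7 : √7 ≠ 0 := by positivity
  have hθ : √7 * -θ₀ = -Real.arccos (3 / 4) := by
    rw [θ₀, mul_neg, mul_inv_cancel_left₀ h7]
  have hsin : (√7)⁻¹ * Real.sin (Real.arccos (3 / 4)) = 1 / 4 := by
    rw [Real.sin_arccos, show (1 - (3 / 4) ^ 2 : ℝ) = 7 / 4 ^ 2 by norm_num,
      Real.sqrt_div (by norm_num), Real.sqrt_sq (by norm_num)]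
    field_simp
  have hcos : Real.cos (Real.arccos (3 / 4)) = 3 / 4 :=
    Real.cos_arccos (by norm_num) (by norm_num)
  simp only [Mflow, hθ, Real.cos_neg, Real.sin_neg, mul_neg, mul_assoc, hsin, hcos]
  refine Prod.ext ?_ ?_ <;> dsimp only <;> module

/-- Metaplectic formulation of the Weyl symbol:
`a_K = (2π)^{n/2} U(θ₀)(G K)`, where `a_K(x,p) = ∫ e^{−i p·y} K(x+y/2, x−y/2) dy`. -/
theorem statement9 (n : ℕ) (K : SchwartzMap (En n × En n) ℂ) (x p : En n) :
    (∫ y : En n, Complex.exp (-(Complex.I * (⟪p, y⟫_ℝ : ℂ))) *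
        K (x + (2⁻¹ : ℝ) • y, x - (2⁻¹ : ℝ) • y))
      = (((2 * Real.pi) ^ ((n : ℝ) / 2) : ℝ) : ℂ) * Uop n θ₀ (GK n (⇑K)) (x, p) := by
  have hc : ((2 * π) ^ ((n : ℝ) / 2) : ℝ) * (2 * π) ^ (-(n : ℝ) / 2) = 1 := by
    rw [← Real.rpow_add (by positivity)]
    ring_nf
    exact Real.rpow_zero _
  simp only [Uop, F2inv, F2_GK, Mflow_neg_θ₀]
  rw [← mul_assoc, ← Complex.ofReal_mul, hc, Complex.ofReal_one, one_mul,
    ← integral_neg_eq_self]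
  simp [real_inner_comm, sub_eq_add_neg]
end
end

section
/- Expectation values via fractional symbols: let K be a Schwartz function on ℝ^n × ℝ^n satisfying K(x,y) = conj(K(y,x)) (self-adjoint kernel), let θ ∈ ℝ, and let a^θ = (2π)^{n/2} U(θ)(G K), where (G K)(x,p) = (2π)^{−n/2} ∫ e^{i p·y} K(x,y) dy. Then for every Schwartz ψ on ℝ^n, ∫∫_{ℝ^n×ℝ^n} K(x,y) ψ(y) conj(ψ(x)) dy dx = ∫∫_{ℝ^n×ℝ^n} conj(a^θ(x,p)) · W^θ(ψ,ψ)(x,p) dx dp. -/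
open MeasureTheory Real SchwartzMap
open scoped InnerProductSpace ComplexConjugate

noncomputable section

open scoped FourierTransform ContDiff

/-! ### Schwartz functions on products -/

section Schwartz

variable {D E : Type*} [NormedAddCommGroup D] [NormedSpace ℝ D]
  [NormedAddCommGroup E] [NormedSpace ℝ E]

theorem norm_iteratedFDeriv_comp_clm_le (f : 𝓢(E, ℂ)) (L : D →L[ℝ] E) (hL : ‖L‖ ≤ 1)
    (i : ℕ) (z : D) :
    ‖iteratedFDeriv ℝ i (fun w => f (L w)) z‖ ≤ ‖iteratedFDeriv ℝ i f (L z)‖ := by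
  have h := L.iteratedFDeriv_comp_right (f.smooth ⊤) z (i := i) (mod_cast le_top)
  change ‖iteratedFDeriv ℝ i (f ∘ L) z‖ ≤ _
  rw [h]
  refine (ContinuousMultilinearMap.norm_compContinuousLinearMap_le _ _).trans ?_
  refine mul_le_of_le_one_right (norm_nonneg _) ?_
  simpa using pow_le_one₀ (norm_nonneg L) hL

/-- The tensor product `(x, y) ↦ f x * g y` of two Schwartz functions. -/
def schwartzTensor (f : 𝓢(D, ℂ)) (g : 𝓢(E, ℂ)) : 𝓢(D × E, ℂ) where
  toFun z := f z.1 * g z.2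
  smooth' := (f.smooth'.comp contDiff_fst).mul (g.smooth'.comp contDiff_snd)
  decay' k m := by
    have hf : ContDiff ℝ ∞ (fun z : D × E => f z.1) := f.smooth'.comp contDiff_fst
    have hg : ContDiff ℝ ∞ (fun z : D × E => g z.2) := g.smooth'.comp contDiff_snd
    refine ⟨∑ i ∈ Finset.range (m + 1), (m.choose i : ℝ) *
      (SchwartzMap.seminorm ℝ k i f * SchwartzMap.seminorm ℝ 0 (m - i) g +
        SchwartzMap.seminorm ℝ 0 i f * SchwartzMap.seminorm ℝ k (m - i) g), fun z => ?_⟩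
    have hmul := norm_iteratedFDeriv_mul_le hf hg z (n := m) (mod_cast le_top)
    refine (mul_le_mul_of_nonneg_left hmul (by positivity)).trans ?_
    rw [Finset.mul_sum]
    refine Finset.sum_le_sum fun i _ => ?_
    have h1 := norm_iteratedFDeriv_comp_clm_le f (ContinuousLinearMap.fst ℝ D E)
      (ContinuousLinearMap.norm_fst_le ℝ D E) i z
    have h2 := norm_iteratedFDeriv_comp_clm_le g (ContinuousLinearMap.snd ℝ D E)
      (ContinuousLinearMap.norm_snd_le ℝ D E) (m - i) z
    simp only [ContinuousLinearMap.coe_fst', ContinuousLinearMap.coe_snd'] at h1 h2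
    have hz : ‖z‖ ^ k ≤ ‖z.1‖ ^ k + ‖z.2‖ ^ k := by
      rcases max_choice ‖z.1‖ ‖z.2‖ with h | h <;> rw [Prod.norm_def, h] <;>
        simp only [le_add_iff_nonneg_right, le_add_iff_nonneg_left] <;> positivity
    have f1 := SchwartzMap.le_seminorm ℝ k i f z.1
    have f2 := SchwartzMap.norm_iteratedFDeriv_le_seminorm ℝ f i z.1
    have g1 := SchwartzMap.le_seminorm ℝ k (m - i) g z.2
    have g2 := SchwartzMap.norm_iteratedFDeriv_le_seminorm ℝ g (m - i) z.2
    calc _ ≤ (‖z.1‖ ^ k + ‖z.2‖ ^ k) * ((m.choose i : ℝ) *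
          ‖iteratedFDeriv ℝ i f z.1‖ * ‖iteratedFDeriv ℝ (m - i) g z.2‖) := by gcongr
      _ = (m.choose i : ℝ) *
          ((‖z.1‖ ^ k * ‖iteratedFDeriv ℝ i f z.1‖) * ‖iteratedFDeriv ℝ (m - i) g z.2‖ +
          ‖iteratedFDeriv ℝ i f z.1‖ * (‖z.2‖ ^ k * ‖iteratedFDeriv ℝ (m - i) g z.2‖)) := by ring
      _ ≤ _ := by gcongr

/-- The slice `y ↦ A (x, y)` of a Schwartz function on a product. -/
def schwartzSlice (A : 𝓢(D × E, ℂ)) (x : D) : 𝓢(E, ℂ) :=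
  SchwartzMap.compCLM ℝ (g := fun y : E => (x, y))
    (by
      have h := ((ContinuousLinearMap.inr ℝ D E).hasTemperateGrowth).add
        (Function.HasTemperateGrowth.const ((x, 0) : D × E))
      convert h using 2
      ext <;> simp)
    ⟨1, 1, fun y => by
      have := norm_snd_le (x, y)
      simp only at this
      linarith⟩ A

@[simp] theorem schwartzSlice_apply (A : 𝓢(D × E, ℂ)) (x : D) (y : E) :
    schwartzSlice A x y = A (x, y) := rfl

/-- The complex conjugate of a Schwartz function. -/
def schwartzConj (f : 𝓢(E, ℂ)) : 𝓢(E, ℂ) :=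
  SchwartzMap.postcompCLM (𝕜 := ℝ) (Complex.conjCLE : ℂ →L[ℝ] ℂ) f

@[simp] theorem schwartzConj_apply (f : 𝓢(E, ℂ)) (x : E) : schwartzConj f x = conj (f x) := rfl

end Schwartz

/-! ### Linear maps of `ℝ^n × ℝ^n` acting by `2 × 2` matrices of determinant one -/

section Block

variable {E : Type*} [NormedAddCommGroup E] [NormedSpace ℝ E]

/-- The action of a `2 × 2` real matrix of determinant one on `E × E`. -/
def blockEquiv (a b c d : ℝ) (h : a * d - b * c = 1) : (E × E) ≃L[ℝ] (E × E) where
  toFun z := (a • z.1 + b • z.2, c • z.1 + d • z.2)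
  invFun z := (d • z.1 + (-b) • z.2, (-c) • z.1 + a • z.2)
  map_add' x y := by ext <;> simp <;> module
  map_smul' r x := by ext <;> simp <;> module
  left_inv z := by
    ext
    · trans (a * d - b * c) • z.1
      · module
      · simp [h]
    · trans (a * d - b * c) • z.2
      · module
      · simp [h]
  right_inv z := by
    ext
    · trans (a * d - b * c) • z.1
      · module
      · simp [h]
    · trans (a * d - b * c) • z.2
      · module
      · simp [h]
  continuous_toFun := by fun_prop
  continuous_invFun := by fun_prop

theorem blockEquiv_apply (a b c d : ℝ) (h : a * d - b * c = 1) (z : E × E) :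
    blockEquiv a b c d h z = (a • z.1 + b • z.2, c • z.1 + d • z.2) := rfl

variable [MeasurableSpace E] [BorelSpace E] [FiniteDimensional ℝ E]
  (μ : Measure E) [μ.IsAddHaarMeasure]

theorem measurePreserving_shear_snd (t : ℝ) :
    MeasurePreserving (fun z : E × E => (z.1, t • z.1 + z.2)) (μ.prod μ) (μ.prod μ) := by
  refine (MeasurePreserving.id μ).skew_product (g := fun x y => t • x + y) (by fun_prop) ?_
  exact Filter.Eventually.of_forall fun x => (measurePreserving_add_left μ (t • x)).map_eq

theorem measurePreserving_shear_fst (t : ℝ) :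
    MeasurePreserving (fun z : E × E => (z.1 + t • z.2, z.2)) (μ.prod μ) (μ.prod μ) := by
  have h := (Measure.measurePreserving_swap (μ := μ) (ν := μ)).comp
    ((measurePreserving_shear_snd μ t).comp (Measure.measurePreserving_swap (μ := μ) (ν := μ)))
  convert h using 1
  ext z <;> simp [add_comm]

theorem measurePreserving_blockEquiv (a b c d : ℝ) (h : a * d - b * c = 1) (hb : b ≠ 0) :
    MeasurePreserving (blockEquiv a b c d h : E × E → E × E) (μ.prod μ) (μ.prod μ) := by
  have H := (measurePreserving_shear_snd μ ((d - 1) / b)).comp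
    ((measurePreserving_shear_fst μ b).comp (measurePreserving_shear_snd μ ((a - 1) / b)))
  convert H using 1
  have hc : c = (a * d - 1) / b := by field_simp; linarith
  ext z
  · simp only [blockEquiv_apply, Function.comp_apply]
    match_scalars <;> field_simp
    ring
  · simp only [blockEquiv_apply, Function.comp_apply, hc]
    match_scalars <;> field_simp <;> ring

theorem measurePreserving_neg_prod :
    MeasurePreserving (fun z : E × E => -z) (μ.prod μ) (μ.prod μ) :=
  (Measure.measurePreserving_neg μ).prod (Measure.measurePreserving_neg μ)

end Block

/-- `M(θ)` as a continuous linear automorphism. -/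
def MflowEquiv (n : ℕ) (θ : ℝ) : (En n × En n) ≃L[ℝ] (En n × En n) :=
  blockEquiv (Real.cos (Real.sqrt 7 * θ) - (Real.sqrt 7)⁻¹ * Real.sin (Real.sqrt 7 * θ))
    (2 * (Real.sqrt 7)⁻¹ * Real.sin (Real.sqrt 7 * θ))
    (-(4 * (Real.sqrt 7)⁻¹ * Real.sin (Real.sqrt 7 * θ)))
    (Real.cos (Real.sqrt 7 * θ) + (Real.sqrt 7)⁻¹ * Real.sin (Real.sqrt 7 * θ)) (by
      have h7 : ((Real.sqrt 7)⁻¹) ^ 2 = 1 / 7 := by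
        rw [inv_pow, Real.sq_sqrt (by norm_num)]; norm_num
      have := Real.sin_sq_add_cos_sq (Real.sqrt 7 * θ)
      linear_combination this + 7 * Real.sin (Real.sqrt 7 * θ) ^ 2 * h7)

theorem measurePreserving_Mflow (n : ℕ) (θ : ℝ) : MeasurePreserving (Mflow n θ) := by
  by_cases hs : Real.sin (Real.sqrt 7 * θ) = 0
  · rcases Real.sin_eq_zero_iff_cos_eq.1 hs with hc | hc
    · have : Mflow n θ = id := by
        ext z <;> simp [Mflow, hs, hc]
      rw [this]
      exact MeasurePreserving.id _
    · have : Mflow n θ = fun z => -z := by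
        ext z <;> simp [Mflow, hs, hc]
      rw [this]
      exact measurePreserving_neg_prod volume
  · refine measurePreserving_blockEquiv volume _ _ _ _ ?_ (by positivity)
    have h7 : ((Real.sqrt 7)⁻¹) ^ 2 = 1 / 7 := by
      rw [inv_pow, Real.sq_sqrt (by norm_num)]; norm_num
    have := Real.sin_sq_add_cos_sq (Real.sqrt 7 * θ)
    linear_combination this + 7 * Real.sin (Real.sqrt 7 * θ) ^ 2 * h7

/-! ### The unitarily normalised Fourier transform -/

theorem rpow_neg_half_sq (n : ℕ) :
    (2 * Real.pi) ^ (-(n : ℝ) / 2) * (2 * Real.pi) ^ (-(n : ℝ) / 2) * (2 * Real.pi) ^ n = 1 := by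
  have h : 0 < 2 * Real.pi := by positivity
  rw [← Real.rpow_add h, ← Real.rpow_natCast, ← Real.rpow_add h]
  ring_nf
  simp

theorem integral_exp_mul_eq_fourierInv (n : ℕ) (f : En n → ℂ) (p : En n) :
    ∫ y : En n, Complex.exp (Complex.I * (⟪y, p⟫_ℝ : ℂ)) * f y
      = 𝓕⁻ f ((2 * Real.pi)⁻¹ • p) := by
  rw [Real.fourierInv_eq']
  congr 1
  ext y
  rw [inner_smul_right, mul_inv_cancel_left₀ (by positivity), smul_eq_mul, mul_comm Complex.I]

theorem integral_exp_neg_mul_eq_fourier (n : ℕ) (f : En n → ℂ) (p : En n) :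
    ∫ y : En n, Complex.exp (-(Complex.I * (⟪p, y⟫_ℝ : ℂ))) * f y
      = 𝓕 f ((2 * Real.pi)⁻¹ • p) := by
  rw [Real.fourier_eq']
  congr 1
  ext y
  rw [inner_smul_right, neg_mul, neg_mul, mul_inv_cancel_left₀ (by positivity), smul_eq_mul,
    mul_comm Complex.I, real_inner_comm]
  push_cast
  ring_nf

theorem F2inv_eq_fourierInv_s15 (n : ℕ) (A : 𝓢(En n × En n, ℂ)) (x p : En n) :
    F2inv n A (x, p) = (((2 * Real.pi) ^ (-(n : ℝ) / 2) : ℝ) : ℂ) *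
      𝓕⁻ (schwartzSlice A x) ((2 * Real.pi)⁻¹ • p) := by
  rw [SchwartzMap.fourierInv_coe, ← integral_exp_mul_eq_fourierInv]
  rfl

theorem GK_eq_F2inv (n : ℕ) (A : En n × En n → ℂ) : GK n A = F2inv n A := by
  ext z
  simp only [GK, F2inv, real_inner_comm]

theorem F2_F2inv (n : ℕ) (A : 𝓢(En n × En n, ℂ)) : F2 n (F2inv n A) = A := by
  ext ⟨x, ξ⟩
  have h2 : (2 * Real.pi) ≠ 0 := by positivity
  simp only [F2, F2inv_eq_fourierInv_s15]
  have h := Measure.integral_comp_inv_smul_of_nonneg (volume : Measure (En n))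
    (fun q : En n => Complex.exp (-(Complex.I * (⟪(2 * Real.pi) • ξ, q⟫_ℝ : ℂ))) *
      𝓕⁻ (schwartzSlice A x) q) (R := 2 * Real.pi) (by positivity)
  rw [integral_exp_neg_mul_eq_fourier, inv_smul_smul₀ h2, ← SchwartzMap.fourier_coe,
    FourierTransform.fourier_fourierInv_eq, finrank_euclideanSpace_fin] at h
  simp only [real_inner_smul_left, inner_smul_right, inv_mul_cancel_left₀ h2] at h
  simp only [mul_left_comm (Complex.exp _)]
  rw [integral_const_mul, h, Complex.real_smul, ← mul_assoc, ← mul_assoc]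
  have hc := congrArg ((↑) : ℝ → ℂ) (rpow_neg_half_sq n)
  push_cast at hc ⊢
  rw [hc, one_mul, schwartzSlice_apply]

theorem conj_FT (n : ℕ) (f : 𝓢(En n, ℂ)) (p : En n) :
    conj (FT n f p) = (((2 * Real.pi) ^ (-(n : ℝ) / 2) : ℝ) : ℂ) *
      ∫ y : En n, Complex.exp (Complex.I * (⟪y, p⟫_ℝ : ℂ)) * conj (f y) := by
  rw [FT, map_mul, Complex.conj_ofReal, ← integral_conj]
  congr 2
  ext y
  rw [map_mul, ← Complex.exp_conj, real_inner_comm]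
  simp

theorem tensor_conj_FT_eq_F2inv (n : ℕ) (f g : 𝓢(En n, ℂ)) :
    (fun w : En n × En n => f w.1 * conj (FT n g w.2))
      = F2inv n (schwartzTensor f (schwartzConj g)) := by
  ext z
  rw [conj_FT, F2inv, mul_left_comm, ← integral_const_mul]
  congr 2
  ext y
  change _ = _ * (f z.1 * conj (g y))
  ring

/-! ### Parseval's identity for the partial transform -/

theorem integral_conj_F2inv_mul_slice (n : ℕ) (A B : 𝓢(En n × En n, ℂ)) (x : En n) :
    ∫ p : En n, conj (F2inv n A (x, p)) * F2inv n B (x, p)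
      = ∫ ξ : En n, conj (A (x, ξ)) * B (x, ξ) := by
  have hP := SchwartzMap.integral_sesq_fourier_fourier (𝓕⁻ (schwartzSlice A x))
    (𝓕⁻ (schwartzSlice B x)) (innerSL ℂ)
  simp only [FourierTransform.fourier_fourierInv_eq, innerSL_apply_apply, RCLike.inner_apply',
    schwartzSlice_apply] at hP
  rw [hP]
  have h := Measure.integral_comp_inv_smul_of_nonneg (volume : Measure (En n))
    (fun q : En n => conj (𝓕⁻ (schwartzSlice A x) q) * 𝓕⁻ (schwartzSlice B x) q)
    (R := 2 * Real.pi) (by positivity)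
  simp only [F2inv_eq_fourierInv_s15, map_mul, Complex.conj_ofReal, mul_mul_mul_comm]
  rw [integral_const_mul, h, Complex.real_smul, ← mul_assoc, finrank_euclideanSpace_fin]
  have hc := congrArg ((↑) : ℝ → ℂ) (rpow_neg_half_sq n)
  push_cast at hc ⊢
  rw [hc, one_mul]

theorem integral_norm_sq_F2inv_slice (n : ℕ) (A : 𝓢(En n × En n, ℂ)) (x : En n) :
    ∫ p : En n, ‖F2inv n A (x, p)‖ ^ 2 = ∫ ξ : En n, ‖A (x, ξ)‖ ^ 2 := by
  have h := integral_conj_F2inv_mul_slice n A A x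
  simp only [Complex.conj_mul', ← Complex.ofReal_pow] at h
  exact Complex.ofReal_injective (integral_ofReal.symm.trans (h.trans integral_ofReal))

instance hasTemperateGrowth_volume_prod (n : ℕ) :
    (volume : Measure (En n × En n)).HasTemperateGrowth :=
  haveI : (volume : Measure (En n × En n)).IsAddHaarMeasure :=
    Measure.prod.instIsAddHaarMeasure (volume : Measure (En n)) (volume : Measure (En n))
  inferInstance

theorem aestronglyMeasurable_F2inv (n : ℕ) (A : 𝓢(En n × En n, ℂ)) :
    AEStronglyMeasurable (F2inv n A) (volume : Measure (En n × En n)) := by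
  refine AEStronglyMeasurable.const_mul (StronglyMeasurable.aestronglyMeasurable ?_) _
  refine StronglyMeasurable.integral_prod_right (f := fun z : En n × En n => fun ξ : En n =>
    Complex.exp (Complex.I * (⟪ξ, z.2⟫_ℝ : ℂ)) * A (z.1, ξ)) ?_
  refine Continuous.stronglyMeasurable ?_
  have := A.continuous
  simp only [Function.uncurry_def]
  fun_prop

theorem memLp_F2inv (n : ℕ) (A : 𝓢(En n × En n, ℂ)) :
    MemLp (F2inv n A) 2 (volume : Measure (En n × En n)) := by
  have hm := aestronglyMeasurable_F2inv n A
  rw [memLp_two_iff_integrable_sq_norm hm]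
  have hA := (memLp_two_iff_integrable_sq_norm A.continuous.aestronglyMeasurable).1
    (A.memLp 2 (volume : Measure (En n × En n)))
  refine (integrable_prod_iff (f := fun z => ‖F2inv n A z‖ ^ 2) (hm.norm.pow 2)).2
    ⟨Filter.Eventually.of_forall fun x => ?_, ?_⟩
  · simp only [F2inv_eq_fourierInv_s15, norm_mul, mul_pow]
    refine Integrable.const_mul ?_ _
    have hs := (memLp_two_iff_integrable_sq_norm
      (𝓕⁻ (schwartzSlice A x)).continuous.aestronglyMeasurable).1
      ((𝓕⁻ (schwartzSlice A x)).memLp 2 (volume : Measure (En n)))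
    exact hs.comp_smul (by positivity)
  · simp only [norm_pow, norm_norm, integral_norm_sq_F2inv_slice]
    exact hA.integral_prod_left

theorem integral_conj_F2inv_mul (n : ℕ) (A B : 𝓢(En n × En n, ℂ)) :
    ∫ z : En n × En n, conj (F2inv n A z) * F2inv n B z
      = ∫ z : En n × En n, conj (A z) * B z := by
  have h1 : Integrable (fun z : En n × En n => conj (F2inv n A z) * F2inv n B z) :=
    MemLp.integrable_mul (p := 2) (q := 2) (memLp_F2inv n A).star (memLp_F2inv n B)
  have h2 : Integrable (fun z : En n × En n => conj (A z) * B z) :=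
    MemLp.integrable_mul (p := 2) (q := 2) (A.memLp 2 volume).star (B.memLp 2 volume)
  rw [Measure.volume_eq_prod] at h1 h2 ⊢
  rw [integral_prod _ h1, integral_prod _ h2]
  simp only [integral_conj_F2inv_mul_slice]

/-- `U(θ)` intertwines composition with `M(-θ)` through `F₂⁻¹`. -/
theorem Uop_F2inv (n : ℕ) (θ : ℝ) (A : 𝓢(En n × En n, ℂ)) :
    Uop n θ (F2inv n A) =
      F2inv n (SchwartzMap.compCLMOfContinuousLinearEquiv ℝ (MflowEquiv n (-θ)) A) := by
  rw [Uop, F2_F2inv]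
  rfl

/-- Expectation values via fractional symbols: for a self-adjoint
Schwartz kernel `K` and `a^θ = (2π)^{n/2} U(θ)(G K)`,
`∫∫ K(x,y) ψ(y) conj(ψ(x)) dy dx = ∫∫ conj(a^θ) W^θ(ψ,ψ)`. -/
theorem statement15 (n : ℕ) (θ : ℝ) (K : SchwartzMap (En n × En n) ℂ)
    (hK : ∀ x y : En n, K (x, y) = conj (K (y, x)))
    (ψ : SchwartzMap (En n) ℂ) :
    (∫ z : En n × En n, K z * ψ z.2 * conj (ψ z.1))
      = ∫ z : En n × En n,
          conj ((((2 * Real.pi) ^ ((n : ℝ) / 2) : ℝ) : ℂ) * Uop n θ (GK n (⇑K)) z) *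
            fWig n θ (⇑ψ) (⇑ψ) z := by
  have hU : ∀ A B : 𝓢(En n × En n, ℂ),
      ∫ z : En n × En n, conj (Uop n θ (F2inv n A) z) * Uop n θ (F2inv n B) z
        = ∫ z : En n × En n, conj (A z) * B z := by
    intro A B
    rw [Uop_F2inv, Uop_F2inv, integral_conj_F2inv_mul]
    exact (measurePreserving_Mflow n (-θ)).integral_comp
      (MflowEquiv n (-θ)).toHomeomorph.measurableEmbedding (fun z => conj (A z) * B z)
  have hc : (((2 * Real.pi) ^ ((n : ℝ) / 2) : ℝ) : ℂ) *
      (((2 * Real.pi) ^ (-(n : ℝ) / 2) : ℝ) : ℂ) = 1 := by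
    rw [← Complex.ofReal_mul, ← Real.rpow_add (by positivity), neg_div, add_neg_cancel,
      Real.rpow_zero, Complex.ofReal_one]
  have hR := hU K (schwartzTensor ψ (schwartzConj ψ))
  rw [← tensor_conj_FT_eq_F2inv, ← GK_eq_F2inv] at hR
  simp only [fWig, map_mul, Complex.conj_ofReal, mul_mul_mul_comm, hc, one_mul]
  rw [hR, Measure.volume_eq_prod, ← (Measure.measurePreserving_swap (μ := (volume : Measure (En n)))
    (ν := (volume : Measure (En n)))).integral_comp MeasurableEquiv.prodComm.measurableEmbedding]
  refine integral_congr_ae (Filter.Eventually.of_forall fun z => ?_)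
  change K (z.2, z.1) * ψ z.1 * conj (ψ z.2) = conj (K (z.1, z.2)) * (ψ z.1 * conj (ψ z.2))
  rw [hK z.2 z.1, mul_assoc]
end
end
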